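/- arXiv:2604.27563 — 4 statements merged into one kernel-verified Lean document; each statement's English description precedes it below -/
import Mathlib

section
/- Under the quadratic Fisher kernel k(ξ,ξ') = (1 + ⟨u(ξ), G⁻¹ u(ξ')⟩)², for every fixed ξᵢ ∈ Ξ the integral b(ξᵢ) = ∫ k(ξ, ξᵢ) dP(ξ) has the closed-form value b(ξᵢ) = 1 + ⟨u(ξᵢ), G⁻¹ u(ξᵢ)⟩. (First part of the paper's Proposition 3.) -/
open MeasureTheory Matrix

theorem integrable_dotProduct_const {Ξ ι : Type*} [MeasurableSpace Ξ] [Fintype ι] {P : Measure Ξ}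
    {u : Ξ → ι → ℝ} (hu : ∀ j, Integrable (fun ξ => u ξ j) P) (w : ι → ℝ) :
    Integrable (fun ξ => u ξ ⬝ᵥ w) P :=
  integrable_finsetSum _ fun j _ => (hu j).mul_const (w j)

theorem integral_dotProduct_const {Ξ ι : Type*} [MeasurableSpace Ξ] [Fintype ι] {P : Measure Ξ}
    {u : Ξ → ι → ℝ} (hu : ∀ j, Integrable (fun ξ => u ξ j) P) (w : ι → ℝ) :
    ∫ ξ, u ξ ⬝ᵥ w ∂P = (fun j => ∫ ξ, u ξ j ∂P) ⬝ᵥ w := by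
  simp only [dotProduct]
  rw [integral_finsetSum _ fun j _ => (hu j).mul_const (w j)]
  simp only [integral_mul_const]

theorem dotProduct_sq_eq_sum {R ι : Type*} [CommSemiring R] [Fintype ι] (x w : ι → R) :
    (x ⬝ᵥ w) ^ 2 = ∑ j, ∑ l, x j * x l * (w j * w l) := by
  simp only [sq, dotProduct, Finset.sum_mul_sum, mul_mul_mul_comm]

theorem integrable_dotProduct_const_sq {Ξ ι : Type*} [MeasurableSpace Ξ] [Fintype ι]
    {P : Measure Ξ} {u : Ξ → ι → ℝ} (hu : ∀ j l, Integrable (fun ξ => u ξ j * u ξ l) P)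
    (w : ι → ℝ) : Integrable (fun ξ => (u ξ ⬝ᵥ w) ^ 2) P := by
  simp only [dotProduct_sq_eq_sum]
  exact integrable_finsetSum _ fun j _ => integrable_finsetSum _ fun l _ =>
    (hu j l).mul_const _

theorem integral_dotProduct_const_sq {Ξ ι : Type*} [MeasurableSpace Ξ] [Fintype ι]
    {P : Measure Ξ} {u : Ξ → ι → ℝ} (hu : ∀ j l, Integrable (fun ξ => u ξ j * u ξ l) P)
    (w : ι → ℝ) :
    ∫ ξ, (u ξ ⬝ᵥ w) ^ 2 ∂P = w ⬝ᵥ (of (fun j l => ∫ ξ, u ξ j * u ξ l ∂P) *ᵥ w) := by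
  simp only [dotProduct_sq_eq_sum]
  rw [integral_finsetSum _ fun j _ => integrable_finsetSum _ fun l _ => (hu j l).mul_const _]
  simp only [mulVec, dotProduct, of_apply, Finset.mul_sum]
  refine Finset.sum_congr rfl fun j _ => ?_
  rw [integral_finsetSum _ fun l _ => (hu j l).mul_const _]
  refine Finset.sum_congr rfl fun l _ => ?_
  rw [integral_mul_const]
  ring

/-- First part of Proposition 3: under the quadratic Fisher kernel
`k(ξ,ξ') = (1 + ⟨u(ξ), G⁻¹ u(ξ')⟩)²`, we have
`∫ k(ξ, ξᵢ) dP(ξ) = 1 + ⟨u(ξᵢ), G⁻¹ u(ξᵢ)⟩`. -/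
theorem stmt_2
    {Ξ : Type*} [MeasurableSpace Ξ] (P : Measure Ξ) [IsProbabilityMeasure P]
    {n : ℕ} (u : Ξ → Fin n → ℝ) (hu : Measurable u)
    (hu_int : ∀ j : Fin n, Integrable (fun ξ => u ξ j) P)
    (hu_mean : ∀ j : Fin n, (∫ ξ, u ξ j ∂P) = 0)
    (huu_int : ∀ j ℓ : Fin n, Integrable (fun ξ => u ξ j * u ξ ℓ) P)
    (G : Matrix (Fin n) (Fin n) ℝ)
    (hG : ∀ j ℓ : Fin n, G j ℓ = ∫ ξ, u ξ j * u ξ ℓ ∂P)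
    (hGinv : IsUnit G.det)
    (ξᵢ : Ξ) :
    (∫ ξ, (1 + u ξ ⬝ᵥ (G⁻¹ *ᵥ u ξᵢ)) ^ 2 ∂P) = 1 + u ξᵢ ⬝ᵥ (G⁻¹ *ᵥ u ξᵢ) := by
  set w := G⁻¹ *ᵥ u ξᵢ with hw
  have hG_eq : of (fun j l => ∫ ξ, u ξ j * u ξ l ∂P) = G := by
    ext j l
    exact (hG j l).symm
  have hGw : G *ᵥ w = u ξᵢ := by
    rw [hw, mulVec_mulVec, mul_nonsing_inv G hGinv, one_mulVec]
  have hlin : ∫ ξ, u ξ ⬝ᵥ w ∂P = 0 := by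
    rw [integral_dotProduct_const hu_int]
    simp [hu_mean, dotProduct]
  have hquad : ∫ ξ, (u ξ ⬝ᵥ w) ^ 2 ∂P = u ξᵢ ⬝ᵥ w := by
    rw [integral_dotProduct_const_sq huu_int, hG_eq, hGw, dotProduct_comm]
  have hint := (integrable_dotProduct_const hu_int w).const_mul 2
  have hint_affine : Integrable (fun ξ => 1 + 2 * (u ξ ⬝ᵥ w)) P :=
    (integrable_const 1).add hint
  calc ∫ ξ, (1 + u ξ ⬝ᵥ w) ^ 2 ∂P
      = ∫ ξ, (1 + 2 * (u ξ ⬝ᵥ w)) + (u ξ ⬝ᵥ w) ^ 2 ∂P := by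
        congr 1 with ξ
        ring
    _ = 1 + u ξᵢ ⬝ᵥ w := by
        rw [integral_add hint_affine (integrable_dotProduct_const_sq huu_int w),
          integral_add (integrable_const 1) hint, integral_const_mul, hlin, hquad]
        simp
end

section
/- Under the quadratic Fisher kernel k(ξ,ξ') = (1 + ⟨u(ξ), G⁻¹ u(ξ')⟩)², the double integral b₀ = ∬ k(ξ,ξ') dP(ξ) dP(ξ') (integral with respect to the product measure P ⊗ P) has the closed-form value b₀ = 1 + n, where n is the dimension of the parameter space. (Second part of the paper's Proposition 3.) -/
open MeasureTheory Matrix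

/-- A bilinear form written as a sum over pairs of indices. -/
lemma dotProduct_mulVec_eq_sum_prod {n : ℕ} (H : Matrix (Fin n) (Fin n) ℝ) (x y : Fin n → ℝ) :
    x ⬝ᵥ (H *ᵥ y) = ∑ q : Fin n × Fin n, H q.1 q.2 * (x q.1 * y q.2) := by
  simp only [dotProduct, mulVec, Finset.mul_sum, Fintype.sum_prod_type]
  exact Finset.sum_congr rfl fun j _ => Finset.sum_congr rfl fun l _ => by ring

/-- For a symmetric invertible matrix, `tr (G G⁻¹ G G⁻¹)` is the dimension. -/
lemma sum_inv_mul_inv_mul_of_isSymm {n : ℕ} (G : Matrix (Fin n) (Fin n) ℝ) (hG : G.IsSymm)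
    (hdet : IsUnit G.det) :
    ∑ q : Fin n × Fin n, ∑ r : Fin n × Fin n,
      G⁻¹ q.1 q.2 * G⁻¹ r.1 r.2 * (G q.1 r.1 * G q.2 r.2) = n := by
  have hrow (l a : Fin n) : ∑ j, G⁻¹ j l * G j a = (1 : Matrix (Fin n) (Fin n) ℝ) a l := by
    rw [← Matrix.mul_nonsing_inv G hdet, Matrix.mul_apply]
    exact Finset.sum_congr rfl fun j _ => by rw [← hG.apply a j, mul_comm]
  have hcol (l a : Fin n) : ∑ b, G⁻¹ a b * G l b = (1 : Matrix (Fin n) (Fin n) ℝ) a l := by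
    rw [← Matrix.nonsing_inv_mul G hdet, Matrix.mul_apply]
    exact Finset.sum_congr rfl fun b _ => by rw [← hG.apply l b]
  calc
    _ = ∑ l, ∑ a, (∑ j, G⁻¹ j l * G j a) * ∑ b, G⁻¹ a b * G l b := by
      simp only [Fintype.sum_prod_type, Finset.sum_mul_sum]
      rw [Finset.sum_comm]
      refine Finset.sum_congr rfl fun l _ => ?_
      rw [Finset.sum_comm]
      exact Finset.sum_congr rfl fun a _ => Finset.sum_congr rfl fun j _ =>
        Finset.sum_congr rfl fun b _ => by ring
    _ = n := by
      simp [hrow, hcol, Matrix.one_apply]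

/-- Second part of Proposition 3: under the quadratic Fisher kernel
`k(ξ,ξ') = (1 + ⟨u(ξ), G⁻¹ u(ξ')⟩)²`, we have
`b₀ = ∬ k(ξ,ξ') dP(ξ) dP(ξ') = 1 + n`. -/
theorem stmt_3
    {Ξ : Type*} [MeasurableSpace Ξ] (P : Measure Ξ) [IsProbabilityMeasure P]
    {n : ℕ} (u : Ξ → Fin n → ℝ) (hu : Measurable u)
    (hu_int : ∀ j : Fin n, Integrable (fun ξ => u ξ j) P)
    (hu_mean : ∀ j : Fin n, (∫ ξ, u ξ j ∂P) = 0)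
    (huu_int : ∀ j ℓ : Fin n, Integrable (fun ξ => u ξ j * u ξ ℓ) P)
    (G : Matrix (Fin n) (Fin n) ℝ)
    (hG : ∀ j ℓ : Fin n, G j ℓ = ∫ ξ, u ξ j * u ξ ℓ ∂P)
    (hGinv : IsUnit G.det) :
    (∫ p : Ξ × Ξ, (1 + u p.1 ⬝ᵥ (G⁻¹ *ᵥ u p.2)) ^ 2 ∂(P.prod P)) = 1 + (n : ℝ) := by
  have hsymm : G.IsSymm := by
    ext j l
    simp only [transpose_apply, hG, mul_comm]
  have hs_int (q : Fin n × Fin n) :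
      Integrable (fun p : Ξ × Ξ => G⁻¹ q.1 q.2 * (u p.1 q.1 * u p.2 q.2)) (P.prod P) :=
    ((hu_int q.1).mul_prod (hu_int q.2)).const_mul _
  have hss_int (q r : Fin n × Fin n) :
      Integrable (fun p : Ξ × Ξ => G⁻¹ q.1 q.2 * G⁻¹ r.1 r.2 *
        ((u p.1 q.1 * u p.1 r.1) * (u p.2 q.2 * u p.2 r.2))) (P.prod P) :=
    ((huu_int q.1 r.1).mul_prod (huu_int q.2 r.2)).const_mul _
  have hs_int' := integrable_finsetSum Finset.univ fun q _ => hs_int q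
  have hss_int' := integrable_finsetSum Finset.univ fun q _ =>
    integrable_finsetSum Finset.univ fun r _ => hss_int q r
  have hexpand (p : Ξ × Ξ) : (1 + u p.1 ⬝ᵥ (G⁻¹ *ᵥ u p.2)) ^ 2 =
      (1 + 2 * ∑ q : Fin n × Fin n, G⁻¹ q.1 q.2 * (u p.1 q.1 * u p.2 q.2)) +
        ∑ q : Fin n × Fin n, ∑ r : Fin n × Fin n, G⁻¹ q.1 q.2 * G⁻¹ r.1 r.2 *
          ((u p.1 q.1 * u p.1 r.1) * (u p.2 q.2 * u p.2 r.2)) := by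
    rw [dotProduct_mulVec_eq_sum_prod, add_sq, one_pow, mul_one, sq (Finset.sum _ _),
      Finset.sum_mul_sum]
    congr 1
    exact Finset.sum_congr rfl fun q _ => Finset.sum_congr rfl fun r _ => by ring
  have hs : ∫ p : Ξ × Ξ, ∑ q : Fin n × Fin n, G⁻¹ q.1 q.2 * (u p.1 q.1 * u p.2 q.2)
      ∂(P.prod P) = 0 := by
    rw [integral_finsetSum _ fun q _ => hs_int q]
    refine Finset.sum_eq_zero fun q _ => ?_
    rw [integral_const_mul, integral_prod_mul (fun ξ => u ξ q.1) (fun ξ => u ξ q.2), hu_mean,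
      zero_mul, mul_zero]
  have hss : ∫ p : Ξ × Ξ, ∑ q : Fin n × Fin n, ∑ r : Fin n × Fin n,
      G⁻¹ q.1 q.2 * G⁻¹ r.1 r.2 * ((u p.1 q.1 * u p.1 r.1) * (u p.2 q.2 * u p.2 r.2))
      ∂(P.prod P) = n := by
    rw [integral_finsetSum _ fun q _ => integrable_finsetSum _ fun r _ => hss_int q r,
      ← sum_inv_mul_inv_mul_of_isSymm G hsymm hGinv]
    refine Finset.sum_congr rfl fun q _ => ?_
    rw [integral_finsetSum _ fun r _ => hss_int q r]
    refine Finset.sum_congr rfl fun r _ => ?_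
    rw [integral_const_mul, integral_prod_mul (fun ξ => u ξ q.1 * u ξ r.1)
      (fun ξ => u ξ q.2 * u ξ r.2), ← hG, ← hG]
  have hlin_int : Integrable (fun p : Ξ × Ξ =>
      1 + 2 * ∑ q : Fin n × Fin n, G⁻¹ q.1 q.2 * (u p.1 q.1 * u p.2 q.2)) (P.prod P) :=
    (integrable_const _).add (hs_int'.const_mul 2)
  rw [integral_congr_ae (ae_of_all _ hexpand), integral_add hlin_int hss_int',
    integral_add (integrable_const _) (hs_int'.const_mul 2), integral_const_mul, hs, hss]
  simp
end

section
/- Let the state-action kernel be k(z,z') = k_x(x,x') + k_F(z,z') with k_F(z,z') = ⟨u(z), G⁻¹ u(z')⟩ the Fisher kernel. Then the n×n matrix-valued double integral B₀ whose (j,ℓ) entry is ∬ k(z,z') u_j(z) u_ℓ(z') d(π⊗π)(z,z') equals the Fisher information matrix G. (This is B₀ = G, the second part of the paper's Proposition 6.) -/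
open MeasureTheory Matrix

/-- A function of the form `g x * h (x, a)` has zero integral against `ν ⊗ₘ κ` if `h (x, ·)` is
`κ x`-centred for almost every `x`. Integrability is not needed, since the Bochner integral of a
non-integrable function vanishes. -/
theorem integral_compProd_mul_eq_zero
    {X A : Type*} [MeasurableSpace X] [MeasurableSpace A]
    {ν : Measure X} [SFinite ν]
    {κ : ProbabilityTheory.Kernel X A} [ProbabilityTheory.IsSFiniteKernel κ]
    (g : X → ℝ) {h : X × A → ℝ} (hh : ∀ᵐ x ∂ν, ∫ a, h (x, a) ∂(κ x) = 0) :
    ∫ z, g z.1 * h z ∂(ν.compProd κ) = 0 := by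
  by_cases hint : Integrable (fun z : X × A => g z.1 * h z) (ν.compProd κ)
  · rw [Measure.integral_compProd hint]
    refine integral_eq_zero_of_ae ?_
    filter_upwards [hh] with x hx
    simp [integral_const_mul, hx]
  · exact integral_undef hint

/-- The Fisher kernel reproduces the Gram matrix of `u`. -/
theorem integrable_and_integral_fisherKernel
    {Z : Type*} [MeasurableSpace Z] {π : Measure Z} [SFinite π]
    {n : ℕ} {u : Z → Fin n → ℝ}
    (huu : ∀ j ℓ : Fin n, Integrable (fun z => u z j * u z ℓ) π)
    {G : Matrix (Fin n) (Fin n) ℝ}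
    (hG : ∀ j ℓ : Fin n, G j ℓ = ∫ z, u z j * u z ℓ ∂π)
    (hGinv : IsUnit G.det) (j ℓ : Fin n) :
    Integrable (fun p : Z × Z => (u p.1 ⬝ᵥ (G⁻¹ *ᵥ u p.2)) * u p.1 j * u p.2 ℓ) (π.prod π) ∧
      ∫ p : Z × Z, (u p.1 ⬝ᵥ (G⁻¹ *ᵥ u p.2)) * u p.1 j * u p.2 ℓ ∂(π.prod π) = G j ℓ := by
  have expand : (fun p : Z × Z => (u p.1 ⬝ᵥ (G⁻¹ *ᵥ u p.2)) * u p.1 j * u p.2 ℓ) =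
      fun p => ∑ a, ∑ b, G⁻¹ a b * ((u p.1 j * u p.1 a) * (u p.2 b * u p.2 ℓ)) := by
    funext p
    simp only [dotProduct, mulVec, Finset.mul_sum, Finset.sum_mul]
    refine Finset.sum_congr rfl fun a _ => Finset.sum_congr rfl fun b _ => ?_
    ring
  have hint : ∀ a b : Fin n, Integrable
      (fun p : Z × Z => G⁻¹ a b * ((u p.1 j * u p.1 a) * (u p.2 b * u p.2 ℓ))) (π.prod π) :=
    fun a b => ((huu j a).mul_prod (huu b ℓ)).const_mul _
  rw [expand]
  refine ⟨integrable_finsetSum _ fun a _ => integrable_finsetSum _ fun b _ => hint a b, ?_⟩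
  rw [integral_finsetSum _ fun a _ => integrable_finsetSum _ fun b _ => hint a b]
  have hterm : ∀ a, ∫ p : Z × Z, ∑ b, G⁻¹ a b * ((u p.1 j * u p.1 a) * (u p.2 b * u p.2 ℓ))
      ∂(π.prod π) = G j a * (G⁻¹ * G) a ℓ := by
    intro a
    rw [integral_finsetSum _ fun b _ => hint a b, Matrix.mul_apply, Finset.mul_sum]
    refine Finset.sum_congr rfl fun b _ => ?_
    rw [integral_const_mul,
      integral_prod_mul (fun z => u z j * u z a) (fun z => u z b * u z ℓ), ← hG, ← hG]
    ring
  simp only [hterm]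
  rw [← Matrix.mul_apply, Matrix.nonsing_inv_mul _ hGinv, Matrix.mul_one]

/-- Second part of Proposition 6: with the state-action kernel
`k(z,z') = k_x(x,x') + ⟨u(z), G⁻¹ u(z')⟩`, the matrix-valued double integral
`B₀` with `(B₀)_{jℓ} = ∬ k(z,z') u_j(z) u_ℓ(z') d(π⊗π)` equals `G`. -/
theorem stmt_9
    {X A : Type*} [MeasurableSpace X] [MeasurableSpace A]
    (ν : Measure X) [SigmaFinite ν]
    (κ : ProbabilityTheory.Kernel X A) [ProbabilityTheory.IsMarkovKernel κ]
    {n : ℕ} (u : X × A → Fin n → ℝ) (hu : Measurable u)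
    (π : Measure (X × A)) (hπ : π = ν.compProd κ)
    (hu0 : ∀ j : Fin n, ∀ᵐ x ∂ν,
      Integrable (fun a => u (x, a) j) (κ x) ∧ (∫ a, u (x, a) j ∂(κ x)) = 0)
    (huu : ∀ j ℓ : Fin n, Integrable (fun z => u z j * u z ℓ) π)
    (G : Matrix (Fin n) (Fin n) ℝ)
    (hG : ∀ j ℓ : Fin n, G j ℓ = ∫ z, u z j * u z ℓ ∂π)
    (hGinv : IsUnit G.det)
    (kx : X → X → ℝ) (hkx : Measurable (Function.uncurry kx))
    (hkxuu : ∀ j ℓ : Fin n, Integrable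
      (fun p : (X × A) × (X × A) => kx p.1.1 p.2.1 * u p.1 j * u p.2 ℓ)
      (π.prod π)) :
    ∀ j ℓ : Fin n,
      (∫ p : (X × A) × (X × A),
          (kx p.1.1 p.2.1 + u p.1 ⬝ᵥ (G⁻¹ *ᵥ u p.2)) * u p.1 j * u p.2 ℓ
          ∂(π.prod π)) = G j ℓ := by
  subst hπ
  intro j ℓ
  obtain ⟨hF, hFG⟩ := integrable_and_integral_fisherKernel huu hG hGinv j ℓ
  have hx : ∫ p : (X × A) × (X × A), kx p.1.1 p.2.1 * u p.1 j * u p.2 ℓ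
      ∂((ν.compProd κ).prod (ν.compProd κ)) = 0 := by
    rw [integral_prod _ (hkxuu j ℓ)]
    exact integral_eq_zero_of_ae <| .of_forall fun z =>
      integral_compProd_mul_eq_zero (fun x' => kx z.1 x' * u z j)
        ((hu0 ℓ).mono fun _ h => h.2)
  simp only [add_mul]
  rw [integral_add (hkxuu j ℓ) hF, hx, hFG, zero_add]
end

section
/- Let z̃₁,…,z̃_m ∈ Z be dictionary points, k̃(z) ∈ ℝ^m the vector with entries k̃(z)_j = k(z, z̃_j), Ũ the n×m matrix with columns u(z̃₁),…,u(z̃_m), α̃ ∈ ℝ^m any vector, and C̃ any m×m real matrix. Then the sparsified posterior gradient moments satisfy: (a) ∫ u(z) ⟨k̃(z), α̃⟩ dπ(z) = Ũ α̃, and (b) the n×n matrix whose (j,ℓ) entry is ∬ (k(z,z') − k̃(z)ᵀ C̃ k̃(z')) u_j(z) u_ℓ(z') d(π⊗π)(z,z') equals G − Ũ C̃ Ũᵀ. (Paper's Proposition 7: E[∇η(θ)|D_t] = Ũ_t α̃_t and Cov[∇η(θ)|D_t] = G − Ũ_t C̃_t Ũ_tᵀ.) -/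
open MeasureTheory Matrix

/-- A function with vanishing conditional means is orthogonal to every function of the state. -/
lemma integral_compProd_fst_mul_eq_zero {X A : Type*} [MeasurableSpace X] [MeasurableSpace A]
    (ν : Measure X) [SFinite ν] (κ : ProbabilityTheory.Kernel X A)
    [ProbabilityTheory.IsSFiniteKernel κ] (v : X × A → ℝ)
    (hv : ∀ᵐ x ∂ν, ∫ a, v (x, a) ∂(κ x) = 0) (f : X → ℝ) :
    ∫ z, f z.1 * v z ∂(ν.compProd κ) = 0 := by
  by_cases h : Integrable (fun z : X × A => f z.1 * v z) (ν.compProd κ)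
  · rw [Measure.integral_compProd h]
    refine integral_eq_zero_of_ae ?_
    filter_upwards [hv] with x hx
    simp [integral_const_mul, hx]
  · exact integral_undef h

lemma dotProduct_mulVec_mul_mul_eq_sum {ι ι' : Type*} [Fintype ι] [Fintype ι']
    (M : Matrix ι ι' ℝ) (x : ι → ℝ) (y : ι' → ℝ) (a b : ℝ) :
    (x ⬝ᵥ (M *ᵥ y)) * a * b = ∑ i, ∑ k, M i k * ((x i * a) * (y k * b)) := by
  simp only [dotProduct, mulVec, Finset.mul_sum, Finset.sum_mul]
  exact Finset.sum_congr rfl fun i _ => Finset.sum_congr rfl fun k _ => by ring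

section Bilinear

variable {Z ι ι' : Type*} [MeasurableSpace Z] [Fintype ι] [Fintype ι']
  {μ : Measure Z} {f : Z → ι → ℝ} {g : Z → ι' → ℝ} {a b : Z → ℝ}

lemma integrable_prod_dotProduct_mulVec (M : Matrix ι ι' ℝ)
    (hf : ∀ i, Integrable (fun z => f z i * a z) μ)
    (hg : ∀ k, Integrable (fun z => g z k * b z) μ) :
    Integrable (fun p : Z × Z => (f p.1 ⬝ᵥ (M *ᵥ g p.2)) * a p.1 * b p.2) (μ.prod μ) := by
  simp only [dotProduct_mulVec_mul_mul_eq_sum]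
  exact integrable_finsetSum _ fun i _ => integrable_finsetSum _ fun k _ =>
    ((hf i).mul_prod (hg k)).const_mul _

lemma integral_prod_dotProduct_mulVec [SFinite μ] (M : Matrix ι ι' ℝ)
    (hf : ∀ i, Integrable (fun z => f z i * a z) μ)
    (hg : ∀ k, Integrable (fun z => g z k * b z) μ) :
    ∫ p : Z × Z, (f p.1 ⬝ᵥ (M *ᵥ g p.2)) * a p.1 * b p.2 ∂(μ.prod μ) =
      (fun i => ∫ z, f z i * a z ∂μ) ⬝ᵥ (M *ᵥ fun k => ∫ z, g z k * b z ∂μ) := by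
  have key (i : ι) (k : ι') : Integrable
      (fun p : Z × Z => M i k * ((f p.1 i * a p.1) * (g p.2 k * b p.2))) (μ.prod μ) :=
    ((hf i).mul_prod (hg k)).const_mul _
  have h := dotProduct_mulVec_mul_mul_eq_sum M (fun i => ∫ z, f z i * a z ∂μ)
    (fun k => ∫ z, g z k * b z ∂μ) 1 1
  simp only [mul_one] at h
  rw [h]
  simp only [dotProduct_mulVec_mul_mul_eq_sum]
  rw [integral_finsetSum _ fun i _ => integrable_finsetSum _ fun k _ => key i k]
  refine Finset.sum_congr rfl fun i _ => ?_
  rw [integral_finsetSum _ fun k _ => key i k]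
  refine Finset.sum_congr rfl fun k _ => ?_
  rw [integral_const_mul, integral_prod_mul (fun z => f z i * a z) (fun z => g z k * b z)]

end Bilinear

/-- Proposition 7 (sparsified posterior gradient moments):
(a) `∫ u(z) ⟨k̃(z), α̃⟩ dπ(z) = Ũ α̃`, and
(b) `∬ (k(z,z') − k̃(z)ᵀ C̃ k̃(z')) u_j(z) u_ℓ(z') d(π⊗π) = (G − Ũ C̃ Ũᵀ)_{jℓ}`. -/
theorem stmt_10
    {X A : Type*} [MeasurableSpace X] [MeasurableSpace A]
    (ν : Measure X) [SigmaFinite ν]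
    (κ : ProbabilityTheory.Kernel X A) [ProbabilityTheory.IsMarkovKernel κ]
    {n : ℕ} (u : X × A → Fin n → ℝ) (hu : Measurable u)
    (π : Measure (X × A)) (hπ : π = ν.compProd κ)
    (hu0 : ∀ j : Fin n, ∀ᵐ x ∂ν,
      Integrable (fun a => u (x, a) j) (κ x) ∧ (∫ a, u (x, a) j ∂(κ x)) = 0)
    (huu : ∀ j ℓ : Fin n, Integrable (fun z => u z j * u z ℓ) π)
    (G : Matrix (Fin n) (Fin n) ℝ)
    (hG : ∀ j ℓ : Fin n, G j ℓ = ∫ z, u z j * u z ℓ ∂π)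
    (hGinv : IsUnit G.det)
    (kx : X → X → ℝ) (hkx : Measurable (Function.uncurry kx))
    {m : ℕ} (zt : Fin m → X × A)
    (hkxu : ∀ (i : Fin m) (j : Fin n),
      Integrable (fun z : X × A => kx z.1 (zt i).1 * u z j) π)
    (hkxuu : ∀ j ℓ : Fin n, Integrable
      (fun p : (X × A) × (X × A) => kx p.1.1 p.2.1 * u p.1 j * u p.2 ℓ)
      (π.prod π))
    (ktil : X × A → Fin m → ℝ)
    (hktil : ∀ (z : X × A) (i : Fin m),
      ktil z i = kx z.1 (zt i).1 + u z ⬝ᵥ (G⁻¹ *ᵥ u (zt i)))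
    (U : Matrix (Fin n) (Fin m) ℝ)
    (hU : ∀ (j : Fin n) (i : Fin m), U j i = u (zt i) j)
    (α : Fin m → ℝ) (C : Matrix (Fin m) (Fin m) ℝ) :
    (∀ j : Fin n, (∫ z, u z j * (ktil z ⬝ᵥ α) ∂π) = (U *ᵥ α) j) ∧
    (∀ j ℓ : Fin n,
      (∫ p : (X × A) × (X × A),
          (kx p.1.1 p.2.1 + u p.1 ⬝ᵥ (G⁻¹ *ᵥ u p.2)
            - ktil p.1 ⬝ᵥ (C *ᵥ ktil p.2)) * u p.1 j * u p.2 ℓ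
          ∂(π.prod π)) = G j ℓ - (U * C * Uᵀ) j ℓ) := by
  subst hπ
  have hzero (j : Fin n) (f : X → ℝ) : ∫ z, f z.1 * u z j ∂(ν.compProd κ) = 0 :=
    integral_compProd_fst_mul_eq_zero ν κ (fun z => u z j) ((hu0 j).mono fun _ h => h.2) f
  have hscore (w : Fin n → ℝ) (j : Fin n) (z : X × A) :
      (u z ⬝ᵥ w) * u z j = ∑ b, w b * (u z j * u z b) := by
    simp only [dotProduct, Finset.sum_mul]
    exact Finset.sum_congr rfl fun b _ => by ring
  have hscore_int (w : Fin n → ℝ) (j : Fin n) :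
      Integrable (fun z => (u z ⬝ᵥ w) * u z j) (ν.compProd κ) := by
    simp only [hscore]
    exact integrable_finsetSum _ fun b _ => (huu j b).const_mul _
  have hscore_eq (w : Fin n → ℝ) (j : Fin n) :
      ∫ z, (u z ⬝ᵥ w) * u z j ∂(ν.compProd κ) = (G *ᵥ w) j := by
    simp only [hscore]
    rw [integral_finsetSum _ fun b _ => (huu j b).const_mul _]
    simp only [integral_const_mul, ← hG, mulVec, dotProduct, mul_comm]
  have hk_int (i : Fin m) (j : Fin n) :
      Integrable (fun z => ktil z i * u z j) (ν.compProd κ) := by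
    simp only [hktil, add_mul]
    exact (hkxu i j).add (hscore_int _ j)
  have hk_eq (i : Fin m) (j : Fin n) :
      ∫ z, ktil z i * u z j ∂(ν.compProd κ) = U j i := by
    simp only [hktil, add_mul]
    rw [integral_add (hkxu i j) (hscore_int _ j), hzero j fun x => kx x (zt i).1,
      hscore_eq, mulVec_mulVec, mul_nonsing_inv _ hGinv, one_mulVec, hU, zero_add]
  refine ⟨fun j => ?_, fun j ℓ => ?_⟩
  · have h (z : X × A) : u z j * (ktil z ⬝ᵥ α) = ∑ i, α i * (ktil z i * u z j) := by
      simp only [dotProduct, Finset.mul_sum]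
      exact Finset.sum_congr rfl fun i _ => by ring
    simp only [h]
    rw [integral_finsetSum _ fun i _ => (hk_int i j).const_mul _]
    simp only [integral_const_mul, hk_eq, mulVec, dotProduct]
    exact Finset.sum_congr rfl fun i _ => mul_comm _ _
  · have hstate : ∫ p : (X × A) × (X × A), kx p.1.1 p.2.1 * u p.1 j * u p.2 ℓ
        ∂((ν.compProd κ).prod (ν.compProd κ)) = 0 := by
      rw [integral_prod _ (hkxuu j ℓ)]
      exact integral_eq_zero_of_ae (.of_forall fun z => hzero ℓ fun x => kx z.1 x * u z j)
    have hu_int := integrable_prod_dotProduct_mulVec G⁻¹ (fun i => huu i j) fun k => huu k ℓ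
    have hc_int := integrable_prod_dotProduct_mulVec C (fun i => hk_int i j) fun k => hk_int k ℓ
    simp only [sub_mul, add_mul]
    rw [integral_sub (by exact (hkxuu j ℓ).add hu_int) hc_int, integral_add (hkxuu j ℓ) hu_int, hstate,
      integral_prod_dotProduct_mulVec G⁻¹ (fun i => huu i j) fun k => huu k ℓ,
      integral_prod_dotProduct_mulVec C (fun i => hk_int i j) fun k => hk_int k ℓ]
    have hsymm (i k : Fin n) : G i k = G k i := by simp only [hG, mul_comm]
    have hcol : (G⁻¹ *ᵥ fun k => G k ℓ) = Pi.single ℓ 1 := by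
      have : (fun k => G k ℓ) = G *ᵥ Pi.single ℓ 1 := by
        rw [mulVec_single_one]; rfl
      rw [this, mulVec_mulVec, nonsing_inv_mul _ hGinv, one_mulVec]
    simp only [← hG, hk_eq]
    rw [hcol, dotProduct_single_one, hsymm ℓ j, zero_add, dotProduct_mulVec]
    rfl
end
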